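/- Let μ ∈ (0,1), let i ≥ 0 be an integer, let A be a finite nonempty set of integers with A ⊆ [2^i/μ, 2^{i+1}/μ), let B be a finite nonempty set of nonnegative integers with B ⊆ [0, 2^i/μ), and let B̃ = { 2^i · ⌊b/2^i⌋ : b ∈ B }. Then A + B̃ approximates A + B with factor 1−μ. -/

import Mathlib

open Pointwise

/-- `S'` approximates `S` with factor `1-μ`. -/
def ApproxFactor (μ : ℝ) (S S' : Set ℤ) : Prop :=
  (∀ s ∈ S, ∃ s' ∈ S', (1 - μ) * (s : ℝ) ≤ (s' : ℝ) ∧ (s' : ℝ) ≤ (s : ℝ)) ∧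
  (∀ s' ∈ S', ∃ s ∈ S, (s' : ℝ) ≤ (s : ℝ) ∧ (s : ℝ) ≤ (s' : ℝ) / (1 - μ))

/-- Rounding the nonnegative integer `b` down to a multiple of `d` changes `a + b` by a factor of at
least `1 - μ`, as long as `d / μ ≤ a`. -/
theorem add_mul_ediv_bounds {μ : ℝ} (hμ : 0 < μ) {a b d : ℤ} (hd : 0 < d)
    (ha : (d : ℝ) / μ ≤ a) (hb : 0 ≤ b) :
    (1 - μ) * ((a + b : ℤ) : ℝ) ≤ ((a + d * (b / d) : ℤ) : ℝ) ∧
      ((a + d * (b / d) : ℤ) : ℝ) ≤ ((a + b : ℤ) : ℝ) := by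
  have hle : d * (b / d) ≤ b := Int.mul_ediv_self_le hd.ne'
  have hlt : b < d * (b / d) + d := Int.lt_mul_ediv_self_add hd
  have hlt' : (b : ℝ) < ((d * (b / d) : ℤ) : ℝ) + d := by exact_mod_cast hlt
  have hda : (d : ℝ) ≤ a * μ := (div_le_iff₀ hμ).mp ha
  have hμb : 0 ≤ μ * (b : ℝ) := mul_nonneg hμ.le (by exact_mod_cast hb)
  refine ⟨?_, by exact_mod_cast Int.add_le_add_left hle a⟩
  rw [Int.cast_add, Int.cast_add]
  linarith

theorem stmt12 (μ : ℝ) (hμ0 : 0 < μ) (hμ1 : μ < 1) (i : ℕ)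
    (A B : Finset ℤ) (hA : A.Nonempty) (hB : B.Nonempty)
    (hAmem : ∀ a ∈ A, (2 : ℝ) ^ i / μ ≤ (a : ℝ) ∧ (a : ℝ) < 2 ^ (i + 1) / μ)
    (hBmem : ∀ b ∈ B, 0 ≤ b ∧ (b : ℝ) < 2 ^ i / μ) :
    ApproxFactor μ ((A + B : Finset ℤ) : Set ℤ)
      ((A + B.image fun b => 2 ^ i * (b / 2 ^ i) : Finset ℤ) : Set ℤ) := by
  have key : ∀ a ∈ A, ∀ b ∈ B,
      (1 - μ) * ((a + b : ℤ) : ℝ) ≤ ((a + 2 ^ i * (b / 2 ^ i) : ℤ) : ℝ) ∧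
        ((a + 2 ^ i * (b / 2 ^ i) : ℤ) : ℝ) ≤ ((a + b : ℤ) : ℝ) := fun a ha b hb =>
    add_mul_ediv_bounds hμ0 (by positivity) (by simpa using (hAmem a ha).1) (hBmem b hb).1
  constructor
  · intro s hs
    obtain ⟨a, ha, b, hb, rfl⟩ := Finset.mem_add.mp (Finset.mem_coe.mp hs)
    exact ⟨_, Finset.mem_coe.mpr (Finset.add_mem_add ha (Finset.mem_image_of_mem _ hb)),
      key a ha b hb⟩
  · intro s hs
    obtain ⟨a, ha, t, ht, rfl⟩ := Finset.mem_add.mp (Finset.mem_coe.mp hs)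
    obtain ⟨b, hb, rfl⟩ := Finset.mem_image.mp ht
    obtain ⟨hlow, hupp⟩ := key a ha b hb
    refine ⟨a + b, Finset.mem_coe.mpr (Finset.add_mem_add ha hb), hupp, ?_⟩
    rw [le_div_iff₀ (sub_pos.mpr hμ1), mul_comm]
    exact hlow
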